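/- arXiv:2408.15703 — 6 statements merged into one kernel-verified Lean document; each statement's English description precedes it below -/
import Mathlib

section
/- Let A ∈ ℝ^{n×n} be invertible and, for each i = 1,…,N, let R_i be symmetric positive definite and let (P_i^OL, K_i^OL) satisfy the coupled open-loop Riccati equations P_i^OL = Q_i + Aᵀ P_i^OL Ā^OL and K_i^OL = −R_i⁻¹ B_iᵀ P_i^OL Ā^OL, where Ā^OL := A + Σ_{j=1}^N B_j K_j^OL. Then the matrix I + Σ_{i=1}^N S_i P_i^OL is invertible and Ā^OL = (I + Σ_{i=1}^N S_i P_i^OL)⁻¹ A. -/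
open Matrix BigOperators

noncomputable section

theorem stmt1 {n m N : ℕ}
    (A : Matrix (Fin n) (Fin n) ℝ)
    (B : Fin N → Matrix (Fin n) (Fin m) ℝ)
    (Q : Fin N → Matrix (Fin n) (Fin n) ℝ)
    (R : Fin N → Matrix (Fin m) (Fin m) ℝ)
    (P : Fin N → Matrix (Fin n) (Fin n) ℝ)
    (K : Fin N → Matrix (Fin m) (Fin n) ℝ)
    (S : Fin N → Matrix (Fin n) (Fin n) ℝ)
    (Abar : Matrix (Fin n) (Fin n) ℝ)
    (hA : IsUnit A.det)
    (hR : ∀ i, (R i).PosDef)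
    (hQ : ∀ i, (Q i).PosSemidef)
    (hS : ∀ i, S i = B i * (R i)⁻¹ * (B i)ᵀ)
    (hAbar : Abar = A + ∑ j, B j * K j)
    (hP : ∀ i, P i = Q i + Aᵀ * P i * Abar)
    (hK : ∀ i, K i = -((R i)⁻¹ * (B i)ᵀ * P i * Abar)) :
    IsUnit (1 + ∑ i, S i * P i).det ∧
    Abar = (1 + ∑ i, S i * P i)⁻¹ * A := by
  have hmul : (1 + ∑ i, S i * P i) * Abar = A := by
    have hsum : ∑ j, B j * K j = -((∑ i, S i * P i) * Abar) := by
      rw [Finset.sum_mul, ← Finset.sum_neg_distrib]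
      refine Finset.sum_congr rfl fun i _ => ?_
      rw [hK, hS, Matrix.mul_neg]
      simp only [Matrix.mul_assoc]
    rw [hsum] at hAbar
    rw [Matrix.add_mul, Matrix.one_mul]
    exact eq_sub_iff_add_eq.mp (hAbar.trans (sub_eq_add_neg _ _).symm)
  have hdet : IsUnit (1 + ∑ i, S i * P i).det := by
    rw [← hmul, Matrix.det_mul] at hA
    exact isUnit_of_mul_isUnit_left hA
  refine ⟨hdet, ?_⟩
  rw [← hmul, Matrix.nonsing_inv_mul_cancel_left _ _ hdet]
end
end

section
/- For each i, let Q_i be symmetric positive semidefinite and R_i symmetric positive definite, let (P_i^OL, K_i^OL) satisfy the coupled open-loop Riccati equations P_i^OL = Q_i + AᵀP_i^OL Ā^OL, K_i^OL = −R_i⁻¹B_iᵀP_i^OL Ā^OL with Ā^OL = A + Σ_j B_j K_j^OL, and let (P_i^LQR, K_i^LQR) satisfy the LQR Riccati equations P_i^LQR = Q_i + AᵀP_i^LQR Ā_i^LQR, K_i^LQR = −R_i⁻¹B_iᵀP_i^LQR Ā_i^LQR with Ā_i^LQR := A + B_i K_i^LQR, where P_i^LQR is symmetric positive semidefinite. Then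 P̃_i := P_i^OL − P_i^LQR satisfies the Stein-type equation P̃_i = (Ā_i^LQR)ᵀ P̃_i Ā^OL + (Ā_i^LQR)ᵀ P_i^LQR ( Σ_{j≠i} B_j K_j^OL ), and K̃_i := K_i^OL − K_i^LQR satisfies K̃_i = −(R_i + B_iᵀ P_i^LQR B_i)⁻¹ B_iᵀ ( P̃_i Ā^OL + P_i^LQR Σ_{j≠i} B_j K_j^OL ) (the matrix R_i + B_iᵀ P_i^LQR B_i being invertible since R_i ≻ 0 and P_i^LQR ⪰ 0). -/
open Matrix BigOperators

noncomputable section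

/-- A stationarity condition `R K = -Bᵀ P F` for `K`, and the same for `K'` with `P'`, `F'`,
give an identity for the difference of the gains. -/
theorem mul_gain_sub {n m : ℕ} {B : Matrix (Fin n) (Fin m) ℝ} {R : Matrix (Fin m) (Fin m) ℝ}
    {P P' F F' S : Matrix (Fin n) (Fin n) ℝ} {K K' : Matrix (Fin m) (Fin n) ℝ}
    (hF : F = F' + B * (K - K') + S) (hK : R * K = -(Bᵀ * P * F))
    (hK' : R * K' = -(Bᵀ * P' * F')) :
    (R + Bᵀ * P' * B) * (K - K') = -(Bᵀ * ((P - P') * F + P' * S)) := by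
  have hS : S = F - F' - B * (K - K') := by rw [hF]; abel
  rw [Matrix.add_mul, Matrix.mul_sub R, hK, hK', hS]
  simp only [Matrix.mul_add, Matrix.mul_sub, Matrix.sub_mul, Matrix.mul_assoc]
  abel

/-- The Stein-type identity for the difference of the solutions of two Riccati equations. -/
theorem riccati_sub {n m : ℕ} {A Q : Matrix (Fin n) (Fin n) ℝ} {B : Matrix (Fin n) (Fin m) ℝ}
    {R : Matrix (Fin m) (Fin m) ℝ} {P P' F F' S : Matrix (Fin n) (Fin n) ℝ}
    {K K' : Matrix (Fin m) (Fin n) ℝ} (hR : Rᵀ = R) (hP't : P'ᵀ = P')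
    (hF : F = F' + B * (K - K') + S) (hF' : F' = A + B * K')
    (hP : P = Q + Aᵀ * P * F) (hP' : P' = Q + Aᵀ * P' * F')
    (hK : R * K = -(Bᵀ * P * F)) (hK' : R * K' = -(Bᵀ * P' * F')) :
    P - P' = F'ᵀ * (P - P') * F + F'ᵀ * P' * S := by
  have hA : Aᵀ = F'ᵀ - K'ᵀ * Bᵀ := by rw [hF', transpose_add, transpose_mul]; abel
  have hS : S = F - F' - B * (K - K') := by rw [hF]; abel
  have hcross : K'ᵀ * R = -(F'ᵀ * P' * B) := by
    have := congrArg transpose hK'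
    simpa [transpose_mul, hR, hP't, Matrix.mul_assoc] using this
  have hgain : K'ᵀ * (Bᵀ * P * F - Bᵀ * P' * F') = F'ᵀ * P' * B * (K - K') := by
    have : Bᵀ * P * F - Bᵀ * P' * F' = -(R * (K - K')) := by
      rw [Matrix.mul_sub, hK, hK']; abel
    rw [this, Matrix.mul_neg, ← Matrix.mul_assoc, hcross, Matrix.neg_mul, neg_neg]
  have hdiff : P - P' = Aᵀ * P * F - Aᵀ * P' * F' := by
    nth_rewrite 1 [hP]
    nth_rewrite 1 [hP']
    abel
  calc P - P' = F'ᵀ * P * F - F'ᵀ * P' * F' - K'ᵀ * (Bᵀ * P * F - Bᵀ * P' * F') := by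
        rw [hdiff, hA]
        simp only [Matrix.mul_sub, Matrix.sub_mul, Matrix.mul_assoc]
        abel
    _ = F'ᵀ * (P - P') * F + F'ᵀ * P' * S := by
        rw [hgain, hS]
        simp only [Matrix.mul_sub, Matrix.sub_mul, Matrix.mul_assoc]
        abel

theorem stmt3 {n m N : ℕ}
    (A : Matrix (Fin n) (Fin n) ℝ)
    (B : Fin N → Matrix (Fin n) (Fin m) ℝ)
    (Q : Fin N → Matrix (Fin n) (Fin n) ℝ)
    (R : Fin N → Matrix (Fin m) (Fin m) ℝ)
    (Pol : Fin N → Matrix (Fin n) (Fin n) ℝ)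
    (Kol : Fin N → Matrix (Fin m) (Fin n) ℝ)
    (Plqr : Fin N → Matrix (Fin n) (Fin n) ℝ)
    (Klqr : Fin N → Matrix (Fin m) (Fin n) ℝ)
    (Abar : Matrix (Fin n) (Fin n) ℝ)
    (Alqr : Fin N → Matrix (Fin n) (Fin n) ℝ)
    (hQ : ∀ i, (Q i).PosSemidef)
    (hR : ∀ i, (R i).PosDef)
    -- coupled open-loop Riccati equations
    (hAbar : Abar = A + ∑ j, B j * Kol j)
    (hPol : ∀ i, Pol i = Q i + Aᵀ * Pol i * Abar)
    (hKol : ∀ i, Kol i = -((R i)⁻¹ * (B i)ᵀ * Pol i * Abar))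
    -- LQR Riccati equations
    (hAlqr : ∀ i, Alqr i = A + B i * Klqr i)
    (hPlqr : ∀ i, Plqr i = Q i + Aᵀ * Plqr i * Alqr i)
    (hKlqr : ∀ i, Klqr i = -((R i)⁻¹ * (B i)ᵀ * Plqr i * Alqr i))
    (hPlqrPSD : ∀ i, (Plqr i).PosSemidef) :
    (∀ i, IsUnit (R i + (B i)ᵀ * Plqr i * B i).det) ∧
    (∀ i, Pol i - Plqr i =
      (Alqr i)ᵀ * (Pol i - Plqr i) * Abar +
      (Alqr i)ᵀ * Plqr i * (∑ j ∈ Finset.univ.erase i, B j * Kol j)) ∧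
    (∀ i, Kol i - Klqr i =
      -((R i + (B i)ᵀ * Plqr i * B i)⁻¹ * ((B i)ᵀ *
        ((Pol i - Plqr i) * Abar +
          Plqr i * ∑ j ∈ Finset.univ.erase i, B j * Kol j)))) := by
  have hdet : ∀ i, IsUnit (R i + (B i)ᵀ * Plqr i * B i).det := fun i => by
    have h : ((B i)ᵀ * Plqr i * B i).PosSemidef := by
      simpa only [conjTranspose_eq_transpose_of_trivial] using
        (hPlqrPSD i).conjTranspose_mul_mul_same (B i)
    exact ((hR i).add_posSemidef h).det_pos.ne'.isUnit
  have hgain : ∀ i (X : Matrix (Fin n) (Fin n) ℝ) (Y : Matrix (Fin n) (Fin n) ℝ)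
      (K : Matrix (Fin m) (Fin n) ℝ), K = -((R i)⁻¹ * (B i)ᵀ * X * Y) →
      R i * K = -((B i)ᵀ * X * Y) := fun i X Y K h => by
    rw [h, Matrix.mul_neg]
    simp only [Matrix.mul_assoc]
    rw [Matrix.mul_nonsing_inv_cancel_left _ _ (hR i).det_pos.ne'.isUnit]
  have hF : ∀ i, Abar = Alqr i + B i * (Kol i - Klqr i) +
      ∑ j ∈ Finset.univ.erase i, B j * Kol j := fun i => by
    rw [hAbar, hAlqr i, ← Finset.add_sum_erase _ _ (Finset.mem_univ i), Matrix.mul_sub]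
    abel
  refine ⟨hdet, fun i => ?_, fun i => ?_⟩
  · exact riccati_sub (by simpa using (hR i).isHermitian.eq)
      (by simpa using (hPlqrPSD i).isHermitian.eq) (hF i) (hAlqr i) (hPol i) (hPlqr i)
      (hgain i _ _ _ (hKol i)) (hgain i _ _ _ (hKlqr i))
  · rw [← Matrix.mul_neg, ← mul_gain_sub (hF i) (hgain i _ _ _ (hKol i))
      (hgain i _ _ _ (hKlqr i)), Matrix.nonsing_inv_mul_cancel_left _ _ (hdet i)]
end
end

section
/- Fix i and let A, Ā ∈ ℝ^{n×n}, B ∈ ℝ^{n×m}, D ∈ ℝ^{n×n}, Q ∈ ℝ^{n×n}, and R ∈ ℝ^{m×m}. Define Â := [[A, D],[0, Ā]] ∈ ℝ^{2n×2n}, B̂ := [B; 0] ∈ ℝ^{2n×m}, Q̂ := blkdiag(Q, 0). Suppose P̂ ∈ ℝ^{2n×2n}, partitioned in n×n blocks as P̂ = [[P̂¹¹, P̂¹²],[P̂²¹, P̂²²]], and K̂ = [K̂¹, K̂²] ∈ ℝ^{m×2n} satisfy P̂ = Q̂ + Âᵀ P̂ (Â + B̂K̂) and K̂ = −(R + B̂ᵀP̂B̂)⁻¹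 B̂ᵀ P̂ Â, with R + BᵀP̂¹¹B invertible. Then: P̂¹¹ = Q + Aᵀ P̂¹¹ (A + B K̂¹); K̂¹ = −(R + Bᵀ P̂¹¹ B)⁻¹ Bᵀ P̂¹¹ A; and P̂²¹ = Dᵀ P̂¹¹ (A + B K̂¹) + Āᵀ P̂²¹ (A + B K̂¹). -/
open Matrix BigOperators

noncomputable section

theorem stmt4 {n m : ℕ}
    (A Abar D : Matrix (Fin n) (Fin n) ℝ)
    (B : Matrix (Fin n) (Fin m) ℝ)
    (Q : Matrix (Fin n) (Fin n) ℝ)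
    (R : Matrix (Fin m) (Fin m) ℝ)
    (P11 P12 P21 P22 : Matrix (Fin n) (Fin n) ℝ)
    (K1 K2 : Matrix (Fin m) (Fin n) ℝ)
    (Ahat : Matrix (Fin n ⊕ Fin n) (Fin n ⊕ Fin n) ℝ)
    (Bhat : Matrix (Fin n ⊕ Fin n) (Fin m) ℝ)
    (Qhat Phat : Matrix (Fin n ⊕ Fin n) (Fin n ⊕ Fin n) ℝ)
    (Khat : Matrix (Fin m) (Fin n ⊕ Fin n) ℝ)
    (hAhat : Ahat = Matrix.fromBlocks A D 0 Abar)
    (hBhat : Bhat = Matrix.of fun r c => Sum.elim (fun i => B i c) (fun _ => (0 : ℝ)) r)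
    (hQhat : Qhat = Matrix.fromBlocks Q 0 0 0)
    (hPhat : Phat = Matrix.fromBlocks P11 P12 P21 P22)
    (hKhat : Khat = Matrix.of fun r c => Sum.elim (fun i => K1 r i) (fun i => K2 r i) c)
    (hARE : Phat = Qhat + Ahatᵀ * Phat * (Ahat + Bhat * Khat))
    (hgain : Khat = -((R + Bhatᵀ * Phat * Bhat)⁻¹ * (Bhatᵀ * Phat * Ahat)))
    (hinv : IsUnit (R + Bᵀ * P11 * B).det) :
    P11 = Q + Aᵀ * P11 * (A + B * K1) ∧
    K1 = -((R + Bᵀ * P11 * B)⁻¹ * (Bᵀ * P11 * A)) ∧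
    P21 = Dᵀ * P11 * (A + B * K1) + Abarᵀ * P21 * (A + B * K1) := by
  have hB : Bhat = fromRows B 0 := by
    rw [hBhat]
    ext (i | i) j <;> rfl
  have hK : Khat = fromCols K1 K2 := by
    rw [hKhat]
    ext i (j | j) <;> rfl
  rw [hPhat, hQhat, hAhat, hB, hK, fromRows_mul_fromCols, fromBlocks_add,
    fromBlocks_transpose, fromBlocks_multiply, fromBlocks_multiply, fromBlocks_add,
    fromBlocks_inj] at hARE
  rw [hPhat, hAhat, hB, hK, transpose_fromRows, fromCols_mul_fromBlocks,
    fromCols_mul_fromRows, fromCols_mul_fromBlocks, mul_fromCols, fromCols_neg,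
    fromCols_inj.eq_iff] at hgain
  obtain ⟨h11, -, h21, -⟩ := hARE
  refine ⟨?_, ?_, ?_⟩
  · simpa using h11
  · simpa using hgain.1
  · simpa [Matrix.add_mul] using h21
end
end

section
/- Let Q_i be symmetric positive semidefinite, R_i symmetric positive definite, and let K_1^OL,…,K_N^OL ∈ ℝ^{m×n} with Ā^OL := A + Σ_j B_j K_j^OL. Define Â_i := [[A, Σ_{j≠i} B_j K_j^OL],[0, Ā^OL]], B̂_i := [B_i; 0], Q̂_i := blkdiag(Q_i, 0). Suppose P̂_i ∈ ℝ^{2n×2n} is symmetric positive semidefinite and, with gain K̂_i := −(R_i + B̂_iᵀP̂_iB̂_i)⁻¹B̂_iᵀP̂_iÂ_i, satisfies P̂_i = Q̂_i + Â_iᵀP̂_i(Â_i + B̂_iK̂_i); suppose moreover that K̂_i(x; x) = K_i^OL x for all x ∈ ℝⁿ (i.e., the two m×n blocks of K̂_i sum to K_i^OL). Define V_i(x,y) := (1/2)(x;y)ᵀP̂_i(x;y). Then for every x ∈ ℝⁿ: V_i(x, x) = ℓ_i(x, K_i^OL x) + V_i(Ā^OL x, Ā^OL x), where ℓ_i(x,u)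 = (1/2)xᵀQ_i x + (1/2)uᵀR_i u. -/
open Matrix BigOperators

noncomputable section

/-- Quadratic stage cost ℓ(x,u) = ½ xᵀQx + ½ uᵀRu. -/
def stageCost {n m : ℕ} (Q : Matrix (Fin n) (Fin n) ℝ) (R : Matrix (Fin m) (Fin m) ℝ)
    (x : Fin n → ℝ) (u : Fin m → ℝ) : ℝ :=
  (1 / 2) * (x ⬝ᵥ (Q *ᵥ x)) + (1 / 2) * (u ⬝ᵥ (R *ᵥ u))

/-- Cost-to-go quadratic form V(x,y) = ½ (x;y)ᵀ P (x;y). -/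
def quadV {n : ℕ} (P : Matrix (Fin n ⊕ Fin n) (Fin n ⊕ Fin n) ℝ)
    (x y : Fin n → ℝ) : ℝ :=
  (1 / 2) * (Sum.elim x y ⬝ᵥ (P *ᵥ Sum.elim x y))

/-- One-step cost decomposition of a Riccati solution in closed-loop (Joseph) form. -/
theorem riccati_eq_joseph {ι κ : Type*} [Fintype ι] [Fintype κ] [DecidableEq κ]
    {A P Q : Matrix ι ι ℝ} {B : Matrix ι κ ℝ} {R : Matrix κ κ ℝ} {K : Matrix κ ι ℝ}
    (hR : R.PosDef) (hP : P.PosSemidef)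
    (hK : K = -((R + Bᵀ * P * B)⁻¹ * (Bᵀ * P * A)))
    (hARE : P = Q + Aᵀ * P * (A + B * K)) :
    P = Q + Kᵀ * R * K + (A + B * K)ᵀ * P * (A + B * K) := by
  have hpos : (R + Bᵀ * P * B).PosDef := by
    refine hR.add_posSemidef ?_
    simpa [conjTranspose_eq_transpose_of_trivial] using hP.conjTranspose_mul_mul_same B
  have hgain : (R + Bᵀ * P * B) * K = -(Bᵀ * P * A) := by
    rw [hK, Matrix.mul_neg, mul_nonsing_inv_cancel_left _ _ ((isUnit_iff_isUnit_det _).1 hpos.isUnit)]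
  have hstat : R * K + Bᵀ * P * (A + B * K) = 0 := by
    rw [Matrix.mul_add, ← Matrix.mul_assoc, add_left_comm, ← Matrix.add_mul, hgain,
      add_neg_cancel]
  have hdecomp : Kᵀ * R * K + (A + B * K)ᵀ * P * (A + B * K) =
      Aᵀ * P * (A + B * K) + Kᵀ * (R * K + Bᵀ * P * (A + B * K)) := by
    simp only [transpose_add, transpose_mul, Matrix.mul_add, Matrix.add_mul, Matrix.mul_assoc]
    abel
  rw [add_assoc, hdecomp, hstat, Matrix.mul_zero, add_zero]
  exact hARE

/-- A congruence transform evaluated as a quadratic form. -/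
theorem dotProduct_transpose_mul_mul_mulVec {ι κ : Type*} [Fintype ι] [Fintype κ]
    (M : Matrix κ ι ℝ) (S : Matrix κ κ ℝ) (z : ι → ℝ) :
    z ⬝ᵥ ((Mᵀ * S * M) *ᵥ z) = (M *ᵥ z) ⬝ᵥ (S *ᵥ (M *ᵥ z)) := by
  rw [← mulVec_mulVec, ← mulVec_mulVec, dotProduct_mulVec, vecMul_transpose]

theorem stmt8 {n m N : ℕ}
    (A : Matrix (Fin n) (Fin n) ℝ)
    (B : Fin N → Matrix (Fin n) (Fin m) ℝ)
    (Q : Fin N → Matrix (Fin n) (Fin n) ℝ)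
    (R : Fin N → Matrix (Fin m) (Fin m) ℝ)
    (Kol : Fin N → Matrix (Fin m) (Fin n) ℝ)
    (Abar : Matrix (Fin n) (Fin n) ℝ)
    (i : Fin N)
    (Ahat : Matrix (Fin n ⊕ Fin n) (Fin n ⊕ Fin n) ℝ)
    (Bhat : Matrix (Fin n ⊕ Fin n) (Fin m) ℝ)
    (Qhat Phat : Matrix (Fin n ⊕ Fin n) (Fin n ⊕ Fin n) ℝ)
    (Khat : Matrix (Fin m) (Fin n ⊕ Fin n) ℝ)
    (hQ : ∀ j, (Q j).PosSemidef)
    (hR : ∀ j, (R j).PosDef)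
    (hAbar : Abar = A + ∑ j, B j * Kol j)
    (hAhat : Ahat = Matrix.fromBlocks A (∑ j ∈ Finset.univ.erase i, B j * Kol j) 0 Abar)
    (hBhat : Bhat = Matrix.of fun r c => Sum.elim (fun k => B i k c) (fun _ => (0 : ℝ)) r)
    (hQhat : Qhat = Matrix.fromBlocks (Q i) 0 0 0)
    (hPhat : Phat.PosSemidef)
    (hKhat : Khat = -((R i + Bhatᵀ * Phat * Bhat)⁻¹ * (Bhatᵀ * Phat * Ahat)))
    (hARE : Phat = Qhat + Ahatᵀ * Phat * (Ahat + Bhat * Khat))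
    (hKdiag : ∀ x : Fin n → ℝ, Khat *ᵥ Sum.elim x x = Kol i *ᵥ x) :
    ∀ x : Fin n → ℝ,
      quadV Phat x x =
        stageCost (Q i) (R i) x (Kol i *ᵥ x) + quadV Phat (Abar *ᵥ x) (Abar *ᵥ x) := by
  intro x
  have hB : ∀ u, Bhat *ᵥ u = Sum.elim (B i *ᵥ u) 0 := by
    intro u
    subst hBhat
    ext (k | k) <;> simp [mulVec, dotProduct]
  have hclosed : (Ahat + Bhat * Khat) *ᵥ Sum.elim x x = Sum.elim (Abar *ᵥ x) (Abar *ᵥ x) := by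
    rw [add_mulVec, ← mulVec_mulVec, hKdiag, hB, hAhat, fromBlocks_mulVec]
    have hsum : Abar = A + ∑ j ∈ Finset.univ.erase i, B j * Kol j + B i * Kol i := by
      rw [hAbar, add_assoc, Finset.sum_erase_add _ _ (Finset.mem_univ i)]
    have htop : A *ᵥ x + (∑ j ∈ Finset.univ.erase i, B j * Kol j) *ᵥ x + B i *ᵥ (Kol i *ᵥ x) =
        Abar *ᵥ x := by
      rw [mulVec_mulVec, ← add_mulVec, ← add_mulVec, ← hsum]
    ext (k | k)
    · exact congrFun htop k
    · simp
  have hstage : Sum.elim x x ⬝ᵥ (Qhat *ᵥ Sum.elim x x) = x ⬝ᵥ (Q i *ᵥ x) := by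
    simp [hQhat, fromBlocks_mulVec]
  have hform := congrArg (fun M => Sum.elim x x ⬝ᵥ (M *ᵥ Sum.elim x x))
    (riccati_eq_joseph (hR i) hPhat hKhat hARE)
  simp only [add_mulVec _ _ (Sum.elim x x), dotProduct_add, dotProduct_transpose_mul_mul_mulVec,
    hstage, hKdiag] at hform
  rw [← add_mulVec, hclosed] at hform
  unfold quadV stageCost
  rw [hform]
  ring
end
end

section
/- Let Q_i be symmetric positive semidefinite, R_i symmetric positive definite, and let (P_i^CL, K_i^CL) satisfy the coupled closed-loop Riccati equations P_i^CL = Q_i + (Ā_{-i}^CL)ᵀ P_i^CL Ā^CL and K_i^CL = −R_i⁻¹ B_iᵀ P_i^CL Ā^CL, with P_i^CL symmetric positive semidefinite, where Ā^CL = A + Σ_j B_j K_j^CL and Ā_{-i}^CL = A + Σ_{j≠i} B_j K_j^CL. Then for every x ∈ ℝⁿ: (1/2) xᵀ P_i^CL x = min over u ∈ ℝᵐ of ℓ_i(x,u) + (1/2) ‖Ā_{-i}^CL x + B_i u‖²_{P_i^CL}, and the minimum is attained at u = K_i^CL x, where ℓ_i(x,u) = (1/2)xᵀQ_ix + (1/2)uᵀR_iu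 and ‖v‖²_P := vᵀPv. -/
open Matrix BigOperators

noncomputable section

theorem dotProduct_mulVec_comm_of_isHermitian {k : ℕ} {M : Matrix (Fin k) (Fin k) ℝ}
    (hM : M.IsHermitian) (a b : Fin k → ℝ) : a ⬝ᵥ (M *ᵥ b) = b ⬝ᵥ (M *ᵥ a) := by
  have hT : Mᵀ = M := by simpa [Matrix.IsHermitian] using hM
  rw [dotProduct_mulVec, ← mulVec_transpose, hT, dotProduct_comm]

/-- Completion of squares: if `k` is stationary for `u ↦ uᵀRu + (w + Bu)ᵀP(w + Bu)`, the cost at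
`k + d` exceeds the value `wᵀP(w + Bk)` by the quadratic form of `R + BᵀPB` at `d`. -/
theorem quadratic_cost_eq_of_stationary {n m : ℕ}
    {P : Matrix (Fin n) (Fin n) ℝ} {R : Matrix (Fin m) (Fin m) ℝ}
    (B : Matrix (Fin n) (Fin m) ℝ) (hP : P.IsHermitian) (hR : R.IsHermitian)
    (w : Fin n → ℝ) (k d : Fin m → ℝ)
    (hk : R *ᵥ k = -(Bᵀ *ᵥ (P *ᵥ (w + B *ᵥ k)))) :
    (k + d) ⬝ᵥ (R *ᵥ (k + d)) + (w + B *ᵥ (k + d)) ⬝ᵥ (P *ᵥ (w + B *ᵥ (k + d))) =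
      w ⬝ᵥ (P *ᵥ (w + B *ᵥ k)) + d ⬝ᵥ (R *ᵥ d) + (B *ᵥ d) ⬝ᵥ (P *ᵥ (B *ᵥ d)) := by
  have stationary (e : Fin m → ℝ) :
      e ⬝ᵥ (R *ᵥ k) = -((B *ᵥ e) ⬝ᵥ (P *ᵥ (w + B *ᵥ k))) := by
    rw [hk, dotProduct_neg, dotProduct_mulVec, vecMul_transpose]
  have hkk := stationary k
  have hdk := stationary d
  have hRc := dotProduct_mulVec_comm_of_isHermitian hR k d
  have hPw := dotProduct_mulVec_comm_of_isHermitian hP w (B *ᵥ d)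
  have hPk := dotProduct_mulVec_comm_of_isHermitian hP (B *ᵥ k) (B *ᵥ d)
  simp only [mulVec_add, dotProduct_add, add_dotProduct] at *
  linarith

theorem stmt16 {n m N : ℕ}
    (A : Matrix (Fin n) (Fin n) ℝ)
    (B : Fin N → Matrix (Fin n) (Fin m) ℝ)
    (Q : Fin N → Matrix (Fin n) (Fin n) ℝ)
    (R : Fin N → Matrix (Fin m) (Fin m) ℝ)
    (P : Fin N → Matrix (Fin n) (Fin n) ℝ)
    (K : Fin N → Matrix (Fin m) (Fin n) ℝ)
    (Abar : Matrix (Fin n) (Fin n) ℝ)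
    (Ami : Fin N → Matrix (Fin n) (Fin n) ℝ)
    (i : Fin N)
    (hQ : ∀ j, (Q j).PosSemidef)
    (hR : ∀ j, (R j).PosDef)
    (hAbar : Abar = A + ∑ j, B j * K j)
    (hAmi : ∀ j, Ami j = A + ∑ k ∈ Finset.univ.erase j, B k * K k)
    (hP : ∀ j, P j = Q j + (Ami j)ᵀ * P j * Abar)
    (hK : ∀ j, K j = -((R j)⁻¹ * (B j)ᵀ * P j * Abar))
    (hPSD : ∀ j, (P j).PosSemidef) :
    ∀ x : Fin n → ℝ,
      (∀ u : Fin m → ℝ,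
        (1 / 2) * (x ⬝ᵥ (P i *ᵥ x)) ≤
          stageCost (Q i) (R i) x u +
            (1 / 2) * ((Ami i *ᵥ x + B i *ᵥ u) ⬝ᵥ (P i *ᵥ (Ami i *ᵥ x + B i *ᵥ u)))) ∧
      (1 / 2) * (x ⬝ᵥ (P i *ᵥ x)) =
        stageCost (Q i) (R i) x (K i *ᵥ x) +
          (1 / 2) * ((Ami i *ᵥ x + B i *ᵥ (K i *ᵥ x)) ⬝ᵥ
            (P i *ᵥ (Ami i *ᵥ x + B i *ᵥ (K i *ᵥ x)))) := by
  intro x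
  have hsum : Abar = Ami i + B i * K i := by
    rw [hAbar, hAmi i, add_assoc, Finset.sum_erase_add _ _ (Finset.mem_univ i)]
  have hAx : Abar *ᵥ x = Ami i *ᵥ x + B i *ᵥ (K i *ᵥ x) := by
    rw [hsum, add_mulVec, mulVec_mulVec]
  have hRK : R i * K i = -((B i)ᵀ * P i * Abar) := by
    have hdet : IsUnit (R i).det := (hR i).det_pos.ne'.isUnit
    rw [hK i, Matrix.mul_neg, Matrix.mul_assoc, Matrix.mul_assoc,
      mul_nonsing_inv_cancel_left _ _ hdet, Matrix.mul_assoc]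
  have hk : R i *ᵥ (K i *ᵥ x) =
      -((B i)ᵀ *ᵥ (P i *ᵥ (Ami i *ᵥ x + B i *ᵥ (K i *ᵥ x)))) := by
    rw [← hAx, mulVec_mulVec, hRK, neg_mulVec, mulVec_mulVec, mulVec_mulVec]
  have hvalue : x ⬝ᵥ (P i *ᵥ x) = x ⬝ᵥ (Q i *ᵥ x) +
      (Ami i *ᵥ x) ⬝ᵥ (P i *ᵥ (Ami i *ᵥ x + B i *ᵥ (K i *ᵥ x))) := by
    conv_lhs => rw [hP i]
    rw [add_mulVec, dotProduct_add, ← mulVec_mulVec, ← mulVec_mulVec, hAx,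
      dotProduct_mulVec x (Ami i)ᵀ, vecMul_transpose]
  have hcost (d : Fin m → ℝ) :=
    quadratic_cost_eq_of_stationary (B i) (hPSD i).isHermitian (hR i).isHermitian
      (Ami i *ᵥ x) (K i *ᵥ x) d hk
  unfold stageCost
  constructor
  · intro u
    have h := hcost (u - K i *ᵥ x)
    rw [add_sub_cancel] at h
    have hRd : 0 ≤ (u - K i *ᵥ x) ⬝ᵥ (R i *ᵥ (u - K i *ᵥ x)) := by
      simpa using (hR i).posSemidef.dotProduct_mulVec_nonneg (u - K i *ᵥ x)
    have hPd : 0 ≤ (B i *ᵥ (u - K i *ᵥ x)) ⬝ᵥ (P i *ᵥ (B i *ᵥ (u - K i *ᵥ x))) := by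
      simpa using (hPSD i).dotProduct_mulVec_nonneg (B i *ᵥ (u - K i *ᵥ x))
    linarith
  · have h := hcost 0
    simp only [add_zero, mulVec_zero, dotProduct_zero] at h
    linarith
end
end

section
/- Let Q_i ⪰ 0 symmetric, R_i ≻ 0 symmetric, and let (P_i^CL, K_i^CL) satisfy the coupled closed-loop Riccati equations P_i^CL = Q_i + (Ā_{-i}^CL)ᵀ P_i^CL Ā^CL and K_i^CL = −R_i⁻¹ B_iᵀ P_i^CL Ā^CL with P_i^CL symmetric positive semidefinite, where Ā^CL = A + Σ_j B_j K_j^CL and Ā_{-i}^CL = A + Σ_{j≠i} B_j K_j^CL. Then for every horizon T ≥ 1 and every x ∈ ℝⁿ, the minimum over input sequences u_i = (u_i[0],…,u_i[T−1]) ∈ (ℝᵐ)^T of the cost (1/2)‖x[T]‖²_{P_i^CL} + Σ_{t=0}^{T−1} ℓ_i(x[t], u_i[t]), subject to x[0] = x and x[t+1] = Ā_{-i}^CL x[t] + B_i u_i[t], equals (1/2) xᵀ P_i^CL x, and it is attained by the feedback inputs u_i[t] = K_i^CL x[t], i.e., u_i[t] = K_i^CL (Ā^CL)^t x. -/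
open Matrix BigOperators

noncomputable section

/-- Completing the square in one step of the Riccati recursion. -/
theorem stageCost_add_terminal_eq {n m : ℕ} {Q P F G : Matrix (Fin n) (Fin n) ℝ}
    {R : Matrix (Fin m) (Fin m) ℝ} {B : Matrix (Fin n) (Fin m) ℝ} {K : Matrix (Fin m) (Fin n) ℝ}
    (hRs : R.IsSymm) (hPs : P.IsSymm) (hF : F = G + B * K) (hP : P = Q + Gᵀ * P * F)
    (hK : R * K = -(Bᵀ * P * F)) (x : Fin n → ℝ) (u : Fin m → ℝ) :
    (1 / 2) * ((G *ᵥ x + B *ᵥ u) ⬝ᵥ (P *ᵥ (G *ᵥ x + B *ᵥ u))) + stageCost Q R x u =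
      (1 / 2) * (x ⬝ᵥ (P *ᵥ x)) +
        ((1 / 2) * ((u - K *ᵥ x) ⬝ᵥ (R *ᵥ (u - K *ᵥ x))) +
          (1 / 2) * ((B *ᵥ (u - K *ᵥ x)) ⬝ᵥ (P *ᵥ (B *ᵥ (u - K *ᵥ x))))) := by
  have symm_form : ∀ {k : ℕ} {M : Matrix (Fin k) (Fin k) ℝ}, M.IsSymm →
      ∀ v w, v ⬝ᵥ (M *ᵥ w) = w ⬝ᵥ (M *ᵥ v) := by
    intro k M hM v w
    rw [dotProduct_mulVec, ← mulVec_transpose, hM.eq, dotProduct_comm]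
  have transpose_form : ∀ {k l : ℕ} (M : Matrix (Fin k) (Fin l) ℝ) v w,
      v ⬝ᵥ (Mᵀ *ᵥ w) = (M *ᵥ v) ⬝ᵥ w := by
    intro k l M v w
    rw [dotProduct_mulVec, vecMul_transpose]
  have gain : ∀ v, v ⬝ᵥ (R *ᵥ (K *ᵥ x)) = -((B *ᵥ v) ⬝ᵥ (P *ᵥ (F *ᵥ x))) := by
    intro v
    rw [mulVec_mulVec, hK, neg_mulVec, dotProduct_neg, ← mulVec_mulVec, ← mulVec_mulVec,
      transpose_form]
  have value : x ⬝ᵥ (P *ᵥ x) = x ⬝ᵥ (Q *ᵥ x) + (G *ᵥ x) ⬝ᵥ (P *ᵥ (F *ᵥ x)) := by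
    conv_lhs => rw [hP]
    rw [add_mulVec, dotProduct_add, ← mulVec_mulVec, ← mulVec_mulVec, transpose_form]
  have closed : G *ᵥ x = F *ᵥ x - B *ᵥ (K *ᵥ x) := by
    rw [hF, add_mulVec, mulVec_mulVec, add_sub_cancel_right]
  obtain ⟨w, rfl⟩ : ∃ w, u = w + K *ᵥ x := ⟨u - K *ᵥ x, by simp⟩
  have next : G *ᵥ x + B *ᵥ (w + K *ᵥ x) = F *ᵥ x + B *ᵥ w := by
    rw [closed, mulVec_add]; abel
  rw [next, value, closed, add_sub_cancel_right]
  simp only [stageCost, mulVec_add, add_dotProduct, dotProduct_add, sub_dotProduct]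
  rw [symm_form hPs (F *ᵥ x) (B *ᵥ w), symm_form hRs (K *ᵥ x) w, gain w, gain (K *ᵥ x)]
  ring

theorem stmt19 {n m N : ℕ}
    (A : Matrix (Fin n) (Fin n) ℝ)
    (B : Fin N → Matrix (Fin n) (Fin m) ℝ)
    (Q : Fin N → Matrix (Fin n) (Fin n) ℝ)
    (R : Fin N → Matrix (Fin m) (Fin m) ℝ)
    (P : Fin N → Matrix (Fin n) (Fin n) ℝ)
    (K : Fin N → Matrix (Fin m) (Fin n) ℝ)
    (Abar : Matrix (Fin n) (Fin n) ℝ)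
    (Ami : Fin N → Matrix (Fin n) (Fin n) ℝ)
    (i : Fin N)
    (hQ : ∀ j, (Q j).PosSemidef)
    (hR : ∀ j, (R j).PosDef)
    (hAbar : Abar = A + ∑ j, B j * K j)
    (hAmi : ∀ j, Ami j = A + ∑ k ∈ Finset.univ.erase j, B k * K k)
    (hP : ∀ j, P j = Q j + (Ami j)ᵀ * P j * Abar)
    (hK : ∀ j, K j = -((R j)⁻¹ * (B j)ᵀ * P j * Abar))
    (hPSD : ∀ j, (P j).PosSemidef) :
    ∀ (T : ℕ), 1 ≤ T → ∀ x : Fin n → ℝ,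
      -- the optimal value is a lower bound over all input sequences
      (∀ (u : ℕ → Fin m → ℝ) (xs : ℕ → Fin n → ℝ),
        xs 0 = x →
        (∀ t, xs (t + 1) = Ami i *ᵥ xs t + B i *ᵥ u t) →
        (1 / 2) * (x ⬝ᵥ (P i *ᵥ x)) ≤
          (1 / 2) * (xs T ⬝ᵥ (P i *ᵥ xs T)) +
            ∑ t ∈ Finset.range T, stageCost (Q i) (R i) (xs t) (u t)) ∧
      -- and it is attained by the feedback inputs u[t] = K_i^CL (Ā^CL)^t x
      (1 / 2) * (((Abar ^ T) *ᵥ x) ⬝ᵥ (P i *ᵥ ((Abar ^ T) *ᵥ x))) +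
        ∑ t ∈ Finset.range T,
          stageCost (Q i) (R i) ((Abar ^ t) *ᵥ x) (K i *ᵥ ((Abar ^ t) *ᵥ x)) =
        (1 / 2) * (x ⬝ᵥ (P i *ᵥ x)) := by
  have hRs : (R i).IsSymm := (hR i).isHermitian
  have hPs : (P i).IsSymm := (hPSD i).isHermitian
  have hF : Abar = Ami i + B i * K i := by
    rw [hAbar, hAmi, add_assoc, Finset.sum_erase_add _ _ (Finset.mem_univ i)]
  have hRK : R i * K i = -((B i)ᵀ * P i * Abar) := by
    have hdet : IsUnit (R i).det := (hR i).det_pos.ne'.isUnit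
    rw [hK i, Matrix.mul_neg, Matrix.mul_assoc, Matrix.mul_assoc,
      mul_nonsing_inv_cancel_left _ _ hdet, Matrix.mul_assoc]
  have step := stageCost_add_terminal_eq hRs hPs hF (hP i) hRK
  intro T hT x
  clear hT
  constructor
  · rintro u xs rfl hxs
    induction T with
    | zero => simp
    | succ T ih =>
      have hs := step (xs T) (u T)
      rw [← hxs] at hs
      have h₁ := (hR i).posSemidef.dotProduct_mulVec_nonneg (u T - K i *ᵥ xs T)
      have h₂ := (hPSD i).dotProduct_mulVec_nonneg (B i *ᵥ (u T - K i *ᵥ xs T))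
      simp only [star_trivial] at h₁ h₂
      rw [Finset.sum_range_succ]
      linarith
  · induction T with
    | zero => simp
    | succ T ih =>
      have hs := step (Abar ^ T *ᵥ x) (K i *ᵥ (Abar ^ T *ᵥ x))
      have next : Ami i *ᵥ (Abar ^ T *ᵥ x) + B i *ᵥ (K i *ᵥ (Abar ^ T *ᵥ x)) =
          Abar ^ (T + 1) *ᵥ x := by
        rw [mulVec_mulVec _ (B i), ← add_mulVec, ← hF, mulVec_mulVec, ← pow_succ']
      simp only [next, sub_self, mulVec_zero, dotProduct_zero, mul_zero, add_zero] at hs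
      rw [Finset.sum_range_succ]
      linarith
end
end
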